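/- Let d ≥ 1, R = (R_1,…,R_d) with all R_j > 0, u = max{R_1,…,R_d}, v = min{R_1,…,R_d}, and g(R) = (1/R_1 + … + 1/R_d)^{-1}. Then v ≤ d·g(R) ≤ u, and 2^v · (1/(e(d+2u)))^{1/2} ≤ (vol(B_{2R}^d))^{g(R)} ≤ 2^u · ((2v+1)/(2v))^{u/(2v)} · (2eu/d)^{1/2}. -/

import Mathlib

open MeasureTheory

/-- Dilating `x_j` by `t ^ (1 / p_j)` turns the unit sublevel set of `∑ |x_j| ^ p_j` into the
sublevel set of level `t`. -/
lemma volume_sum_abs_rpow_le_eq_mul {ι : Type*} [Fintype ι] {p : ι → ℝ} (hp : ∀ j, 0 < p j)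
    {t : ℝ} (ht : 0 < t) :
    volume {x : ι → ℝ | ∑ j, |x j| ^ p j ≤ t} =
      ENNReal.ofReal (t ^ ∑ j, 1 / p j) * volume {x : ι → ℝ | ∑ j, |x j| ^ p j ≤ 1} := by
  classical
  set D : ι → ℝ := fun j => t ^ (1 / p j) with hD
  have hDpos : ∀ j, 0 < D j := fun j => Real.rpow_pos_of_pos ht _
  have hdet : (Matrix.diagonal D).det = t ^ ∑ j, 1 / p j := by
    rw [Matrix.det_diagonal, Real.rpow_sum_of_pos ht]
  have hpos : 0 < t ^ ∑ j, 1 / p j := Real.rpow_pos_of_pos ht _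
  have hmeas : MeasurableSet {x : ι → ℝ | ∑ j, |x j| ^ p j ≤ t} :=
    measurableSet_le (by fun_prop) (by fun_prop)
  have key := Real.smul_map_diagonal_volume_pi (D := D) (by rw [hdet]; exact hpos.ne')
  conv_lhs => rw [← key]
  rw [Measure.smul_apply, hdet, abs_of_pos hpos, smul_eq_mul,
    Measure.map_apply (LinearMap.continuous_on_pi _).measurable hmeas]
  congr 2
  ext x
  have h : ∀ j, |D j * x j| ^ p j = t * |x j| ^ p j := fun j => by
    rw [abs_mul, Real.mul_rpow (abs_nonneg _) (abs_nonneg _), abs_of_pos (hDpos j), hD,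
      ← Real.rpow_mul ht.le, one_div_mul_cancel (hp j).ne', Real.rpow_one]
  simp only [Set.mem_preimage, Set.mem_ofPred_eq, Matrix.toLin'_apply, Matrix.mulVec_diagonal, h,
    ← Finset.mul_sum]
  rw [mul_le_iff_le_one_right ht]

lemma lintegral_indicator_Ici_exp_neg (c : ℝ) :
    ∫⁻ t, (Set.Ici c).indicator (fun t => ENNReal.ofReal (Real.exp (-t))) t =
      ENNReal.ofReal (Real.exp (-c)) := by
  rw [lintegral_indicator measurableSet_Ici, ← restrict_Ioi_eq_restrict_Ici,
    ← ofReal_integral_eq_lintegral_ofReal (integrableOn_exp_neg_Ioi c)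
      (.of_forall fun _ => (Real.exp_pos _).le), integral_exp_neg_Ioi]

lemma lintegral_exp_neg_eq_lintegral_measure_le {α : Type*} [MeasurableSpace α] (μ : Measure α)
    [SFinite μ] {F : α → ℝ} (hF : Measurable F) (hF0 : ∀ x, 0 ≤ F x) :
    ∫⁻ x, ENNReal.ofReal (Real.exp (-F x)) ∂μ =
      ∫⁻ t in Set.Ioi (0 : ℝ), ENNReal.ofReal (Real.exp (-t)) * μ {x | F x ≤ t} := by
  have hind : ∀ x t, (Set.Ici (F x)).indicator (fun t => ENNReal.ofReal (Real.exp (-t))) t =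
      {q : α × ℝ | F q.1 ≤ q.2}.indicator (fun q => ENNReal.ofReal (Real.exp (-q.2))) (x, t) :=
    fun x t => by simp [Set.indicator]
  have hset : MeasurableSet {q : α × ℝ | F q.1 ≤ q.2} :=
    measurableSet_le (by fun_prop) (by fun_prop)
  have hmeas : Measurable (Function.uncurry fun x t =>
      {q : α × ℝ | F q.1 ≤ q.2}.indicator (fun q => ENNReal.ofReal (Real.exp (-q.2))) (x, t)) :=
    Measurable.indicator (by fun_prop) hset
  rw [lintegral_congr fun x =>
      (lintegral_indicator_Ici_exp_neg (F x)).symm.trans (lintegral_congr (hind x)),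
    lintegral_lintegral_swap hmeas.aemeasurable,
    ← lintegral_indicator measurableSet_Ioi]
  refine lintegral_congr_ae ?_
  filter_upwards [Measure.ae_ne volume (0 : ℝ)] with t ht
  have hslice : ∫⁻ x, {q : α × ℝ | F q.1 ≤ q.2}.indicator
      (fun q => ENNReal.ofReal (Real.exp (-q.2))) (x, t) ∂μ =
      ENNReal.ofReal (Real.exp (-t)) * μ {x | F x ≤ t} := by
    rw [← lintegral_indicator_const (measurableSet_le hF measurable_const)]
    rfl
  rw [hslice]
  by_cases h : 0 < t
  · simp [h]
  · have : {x | F x ≤ t} = ∅ := by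
      ext x
      have := hF0 x
      have : t < 0 := lt_of_le_of_ne (not_lt.mp h) ht
      simp only [Set.mem_ofPred_eq, Set.mem_empty_iff_false, iff_false, not_le]
      linarith
    simp [h, this]

lemma lintegral_exp_neg_sum_abs_rpow {ι : Type*} [Fintype ι] {p : ι → ℝ} (hp : ∀ j, 0 < p j) :
    ∫⁻ x : ι → ℝ, ENNReal.ofReal (Real.exp (-∑ j, |x j| ^ p j)) =
      ENNReal.ofReal (∏ j, 2 * Real.Gamma (1 / p j + 1)) := by
  have hint : ∫ x : ι → ℝ, Real.exp (-∑ j, |x j| ^ p j) =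
      ∏ j, 2 * Real.Gamma (1 / p j + 1) := by
    simp_rw [← Finset.sum_neg_distrib, Real.exp_sum]
    rw [integral_fintype_prod_volume_eq_prod (fun j (x : ℝ) => Real.exp (-|x| ^ p j))]
    refine Finset.prod_congr rfl fun j _ => ?_
    rw [integral_comp_abs (f := fun x => Real.exp (-x ^ p j)), integral_exp_neg_rpow (hp j)]
  have hpos : 0 < ∏ j, 2 * Real.Gamma (1 / p j + 1) := Finset.prod_pos fun j _ =>
    mul_pos two_pos (Real.Gamma_pos_of_pos (by have := hp j; positivity))
  rw [← ofReal_integral_eq_lintegral_ofReal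
    (Integrable.of_integral_ne_zero (by rw [hint]; exact hpos.ne'))
    (.of_forall fun _ => (Real.exp_pos _).le), hint]

/-- The volume of the anisotropic unit ball `∑ |x_j| ^ p_j ≤ 1`. -/
theorem volume_sum_abs_rpow_le_one {ι : Type*} [Fintype ι] {p : ι → ℝ} (hp : ∀ j, 0 < p j) :
    (volume {x : ι → ℝ | ∑ j, |x j| ^ p j ≤ 1}).toReal =
      (∏ j, 2 * Real.Gamma (1 / p j + 1)) / Real.Gamma (∑ j, 1 / p j + 1) := by
  have hA : 0 ≤ ∑ j, 1 / p j := Finset.sum_nonneg fun j _ => (one_div_pos.mpr (hp j)).le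
  have hG : 0 < Real.Gamma (∑ j, 1 / p j + 1) := Real.Gamma_pos_of_pos (by linarith)
  have h := lintegral_exp_neg_eq_lintegral_measure_le (volume : Measure (ι → ℝ))
    (F := fun x => ∑ j, |x j| ^ p j) (by fun_prop) (fun x => by positivity)
  rw [lintegral_exp_neg_sum_abs_rpow hp] at h
  have hGamma : ∫⁻ t in Set.Ioi (0 : ℝ),
      ENNReal.ofReal (Real.exp (-t)) * ENNReal.ofReal (t ^ ∑ j, 1 / p j) =
      ENNReal.ofReal (Real.Gamma (∑ j, 1 / p j + 1)) := by
    have hconv := Real.GammaIntegral_convergent (s := ∑ j, 1 / p j + 1) (by linarith)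
    rw [Real.Gamma_eq_integral (by linarith), ofReal_integral_eq_lintegral_ofReal hconv]
    · refine setLIntegral_congr_fun measurableSet_Ioi fun t _ => ?_
      rw [← ENNReal.ofReal_mul (Real.exp_pos _).le, add_sub_cancel_right]
    · filter_upwards [ae_restrict_mem measurableSet_Ioi] with t ht
      exact mul_nonneg (Real.exp_pos _).le (Real.rpow_nonneg (le_of_lt ht) _)
  have hscale : ∫⁻ t in Set.Ioi (0 : ℝ), ENNReal.ofReal (Real.exp (-t)) *
      volume {x : ι → ℝ | ∑ j, |x j| ^ p j ≤ t} =
      ENNReal.ofReal (Real.Gamma (∑ j, 1 / p j + 1)) *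
        volume {x : ι → ℝ | ∑ j, |x j| ^ p j ≤ 1} := by
    rw [← hGamma, ← lintegral_mul_const _ (by fun_prop)]
    refine setLIntegral_congr_fun measurableSet_Ioi fun t ht => ?_
    rw [volume_sum_abs_rpow_le_eq_mul hp ht, mul_assoc]
  rw [hscale] at h
  have h' := congrArg ENNReal.toReal h
  rw [ENNReal.toReal_mul, ENNReal.toReal_ofReal hG.le, ENNReal.toReal_ofReal] at h'
  · rw [h', mul_div_cancel_left₀ _ hG.ne']
  · exact Finset.prod_nonneg fun j _ => mul_nonneg zero_le_two
      (Real.Gamma_pos_of_pos (by have := hp j; positivity)).le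

lemma rpow_div_exp_le_Gamma_add_one {a : ℝ} (ha : 0 < a) :
    (a / Real.exp 1) ^ a ≤ Real.Gamma (a + 1) := by
  have hconv := Real.GammaIntegral_convergent (s := a + 1) (by linarith)
  have hsub : Set.Ioi a ⊆ Set.Ioi 0 := Set.Ioi_subset_Ioi ha.le
  calc (a / Real.exp 1) ^ a = ∫ t in Set.Ioi a, Real.exp (-t) * a ^ a := by
        rw [integral_mul_const, integral_exp_neg_Ioi, Real.div_rpow ha.le (Real.exp_pos 1).le,
          ← Real.exp_mul, one_mul, Real.exp_neg, div_eq_inv_mul]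
    _ ≤ ∫ t in Set.Ioi a, Real.exp (-t) * t ^ (a + 1 - 1) := by
        refine setIntegral_mono_on ((integrableOn_exp_neg_Ioi a).mul_const _)
          (hconv.mono_set hsub) measurableSet_Ioi fun t ht => ?_
        rw [add_sub_cancel_right]
        exact mul_le_mul_of_nonneg_left (Real.rpow_le_rpow ha.le (le_of_lt ht) ha.le)
          (Real.exp_pos _).le
    _ ≤ ∫ t in Set.Ioi 0, Real.exp (-t) * t ^ (a + 1 - 1) := by
        refine setIntegral_mono_set hconv ?_ hsub.eventuallyLE
        filter_upwards [ae_restrict_mem measurableSet_Ioi] with t ht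
        exact mul_nonneg (Real.exp_pos _).le (Real.rpow_nonneg (le_of_lt ht) _)
    _ = Real.Gamma (a + 1) := (Real.Gamma_eq_integral (by linarith)).symm

lemma Gamma_add_one_le_rpow {a : ℝ} (ha : 0 ≤ a) : Real.Gamma (a + 1) ≤ (a + 1) ^ a := by
  obtain ⟨n, hn⟩ := exists_nat_ge a
  induction n generalizing a with
  | zero =>
    have : a = 0 := le_antisymm (by simpa using hn) ha
    simp [this]
  | succ n ih =>
    rcases le_total a 1 with h1 | h1
    · have hc := Real.convexOn_Gamma.2 (Set.mem_Ioi.mpr one_pos) (Set.mem_Ioi.mpr two_pos)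
        (sub_nonneg.mpr h1) ha (sub_add_cancel 1 a)
      simp only [smul_eq_mul, Real.Gamma_one, Real.Gamma_two, mul_one, sub_add_cancel] at hc
      rw [show 1 - a + a * 2 = a + 1 by ring] at hc
      exact hc.trans (Real.one_le_rpow (by linarith) ha)
    · have hpos : 0 < a := by linarith
      have hih := ih (a := a - 1) (by linarith) (by push_cast at hn; linarith)
      rw [sub_add_cancel] at hih
      rw [Real.Gamma_add_one hpos.ne']
      calc a * Real.Gamma a ≤ a * a ^ (a - 1) := mul_le_mul_of_nonneg_left hih ha
        _ = a ^ a := by rw [Real.rpow_sub_one hpos.ne', mul_div_cancel₀ _ hpos.ne']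
        _ ≤ (a + 1) ^ a := Real.rpow_le_rpow ha (by linarith) ha

/-- The Jensen inequality for the log-convex function `Gamma`. -/
lemma rpow_le_prod_Gamma_add_one {ι : Type*} [Fintype ι] [Nonempty ι] {a : ι → ℝ}
    (ha : ∀ j, 0 < a j) :
    ((∑ j, a j) / (Fintype.card ι * Real.exp 1)) ^ (∑ j, a j) ≤
      ∏ j, Real.Gamma (a j + 1) := by
  have hd : (0 : ℝ) < Fintype.card ι := Nat.cast_pos.mpr Fintype.card_pos
  have hA : 0 < ∑ j, a j := Finset.sum_pos (fun j _ => ha j) Finset.univ_nonempty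
  have hΓ : ∀ j, 0 < Real.Gamma (a j + 1) := fun j =>
    Real.Gamma_pos_of_pos (by linarith [ha j])
  have hJ := Real.convexOn_log_Gamma.map_sum_le (t := Finset.univ)
    (w := fun _ : ι => (Fintype.card ι : ℝ)⁻¹) (p := fun j => a j + 1)
    (fun _ _ => by positivity) (by simp [hd.ne'])
    (fun j _ => Set.mem_Ioi.mpr (by linarith [ha j]))
  have hmean : ∑ j, (Fintype.card ι : ℝ)⁻¹ • (a j + 1) = (∑ j, a j) / Fintype.card ι + 1 := by
    simp only [smul_eq_mul]
    rw [← Finset.mul_sum, Finset.sum_add_distrib]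
    simp only [Finset.sum_const, Finset.card_univ, nsmul_eq_mul]
    field_simp
  rw [hmean] at hJ
  simp only [Function.comp_apply, smul_eq_mul] at hJ
  rw [← Finset.mul_sum, ← Real.log_prod (fun j _ => (hΓ j).ne')] at hJ
  have hlow := rpow_div_exp_le_Gamma_add_one (div_pos hA hd)
  have hlog := (Real.log_le_log (by positivity) hlow).trans hJ
  rw [Real.log_rpow (by positivity), div_div] at hlog
  rw [← Real.log_le_log_iff (by positivity) (Finset.prod_pos fun j _ => hΓ j),
    Real.log_rpow (by positivity)]
  have := mul_le_mul_of_nonneg_left hlog hd.le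
  rwa [← mul_assoc, ← mul_assoc, mul_inv_cancel₀ hd.ne', one_mul,
    mul_div_cancel₀ _ hd.ne'] at this

/-- with `u = max_j R_j`, `v = min_j R_j`,
`g(R) = (1/R_1 + … + 1/R_d)⁻¹`, one has `v ≤ d·g(R) ≤ u` and
`2^v·(1/(e(d+2u)))^{1/2} ≤ (vol B_{2R}^d)^{g(R)}
  ≤ 2^u·((2v+1)/(2v))^{u/(2v)}·(2eu/d)^{1/2}`. -/
theorem stmt_4 (d : ℕ) (hd : 1 ≤ d) (R : Fin d → ℝ) (hR : ∀ j, 0 < R j)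
    (u v : ℝ) (hu : IsGreatest (Set.range R) u) (hv : IsLeast (Set.range R) v)
    (g : ℝ) (hg : g = (∑ j, 1 / R j)⁻¹) :
    (v ≤ d * g ∧ d * g ≤ u) ∧
    (2 : ℝ) ^ v * (1 / (Real.exp 1 * (d + 2 * u))) ^ ((1 : ℝ) / 2)
      ≤ (volume {x : Fin d → ℝ | ∑ j, |x j| ^ (2 * R j) ≤ 1}).toReal ^ g ∧
    (volume {x : Fin d → ℝ | ∑ j, |x j| ^ (2 * R j) ≤ 1}).toReal ^ g
      ≤ (2 : ℝ) ^ u * ((2 * v + 1) / (2 * v)) ^ (u / (2 * v))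
          * (2 * Real.exp 1 * u / d) ^ ((1 : ℝ) / 2) := by
  have : Nonempty (Fin d) := ⟨⟨0, hd⟩⟩
  have hd0 : (0 : ℝ) < d := Nat.cast_pos.mpr hd
  have he : 0 < Real.exp 1 := Real.exp_pos 1
  have hRu : ∀ j, R j ≤ u := fun j => hu.2 ⟨j, rfl⟩
  have hvR : ∀ j, v ≤ R j := fun j => hv.2 ⟨j, rfl⟩
  have hv0 : 0 < v := by
    obtain ⟨j, hj⟩ := hv.1
    exact hj ▸ hR j
  have hvu : v ≤ u := hv.2 hu.1
  have hu0 : 0 < u := hv0.trans_le hvu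
  have hS : 0 < ∑ j, 1 / R j :=
    Finset.sum_pos (fun j _ => one_div_pos.mpr (hR j)) Finset.univ_nonempty
  have hg0 : 0 < g := hg ▸ inv_pos.mpr hS
  have hSv : ∑ j, 1 / R j ≤ d / v := by
    calc ∑ j, 1 / R j ≤ ∑ _j : Fin d, 1 / v :=
          Finset.sum_le_sum fun j _ => one_div_le_one_div_of_le hv0 (hvR j)
      _ = d / v := by simp [div_eq_mul_inv]
  have hSu : d / u ≤ ∑ j, 1 / R j := by
    calc (d : ℝ) / u = ∑ _j : Fin d, 1 / u := by simp [div_eq_mul_inv]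
      _ ≤ ∑ j, 1 / R j := Finset.sum_le_sum fun j _ => one_div_le_one_div_of_le (hR j) (hRu j)
  have hvg : v ≤ d * g := by
    rw [hg, ← div_eq_mul_inv, le_div_iff₀ hS]
    rw [le_div_iff₀ hv0] at hSv
    linarith
  have hgu : d * g ≤ u := by
    rw [hg, ← div_eq_mul_inv, div_le_iff₀ hS]
    rw [div_le_iff₀ hu0] at hSu
    linarith
  refine ⟨⟨hvg, hgu⟩, ?_⟩
  have hRR : ∀ j, 0 < 2 * R j := fun j => mul_pos two_pos (hR j)
  have ha : ∀ j, 0 < 1 / (2 * R j) := fun j => one_div_pos.mpr (hRR j)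
  have hAS : ∑ j, 1 / (2 * R j) = (∑ j, 1 / R j) / 2 := by
    rw [Finset.sum_div]
    exact Finset.sum_congr rfl fun j _ => by rw [div_div, mul_comm]
  have hvol := volume_sum_abs_rpow_le_one hRR
  have hP := rpow_le_prod_Gamma_add_one ha
  rw [Fintype.card_fin] at hP
  have hPu : ∏ j, Real.Gamma (1 / (2 * R j) + 1) ≤
      ((2 * v + 1) / (2 * v)) ^ (∑ j, 1 / (2 * R j)) := by
    rw [Real.rpow_sum_of_pos (by positivity)]
    refine Finset.prod_le_prod (fun j _ => (Real.Gamma_pos_of_pos (by linarith [ha j])).le)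
      fun j _ => (Gamma_add_one_le_rpow (ha j).le).trans
        (Real.rpow_le_rpow (by linarith [ha j]) ?_ (ha j).le)
    have : 1 / (2 * R j) ≤ 1 / (2 * v) :=
      one_div_le_one_div_of_le (by positivity) (by linarith [hvR j])
    calc 1 / (2 * R j) + 1 ≤ 1 / (2 * v) + 1 := by linarith
      _ = (2 * v + 1) / (2 * v) := by field_simp; ring
  rw [Finset.prod_mul_distrib] at hvol
  simp only [Finset.prod_const, Finset.card_univ, Fintype.card_fin] at hvol
  set A := ∑ j, 1 / (2 * R j)
  set P := ∏ j, Real.Gamma (1 / (2 * R j) + 1)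
  have hA0 : 0 < A := by rw [hAS]; positivity
  have hAg : A * g = 1 / 2 := by
    rw [hAS, hg]
    field_simp
  have hP0 : 0 < P := Finset.prod_pos fun j _ => Real.Gamma_pos_of_pos (by linarith [ha j])
  have hG0 : 0 < Real.Gamma (A + 1) := Real.Gamma_pos_of_pos (by linarith)
  have hGl := Real.rpow_le_rpow (by positivity) (rpow_div_exp_le_Gamma_add_one hA0) hg0.le
  have hGu := Real.rpow_le_rpow hG0.le (Gamma_add_one_le_rpow hA0.le) hg0.le
  have hPl' := Real.rpow_le_rpow (by positivity) hP hg0.le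
  have hPu' := Real.rpow_le_rpow hP0.le hPu hg0.le
  rw [← Real.rpow_mul (by positivity), hAg] at hGl hGu hPl' hPu'
  rw [hvol, Real.div_rpow (by positivity) hG0.le, Real.mul_rpow (by positivity) hP0.le,
    ← Real.rpow_natCast, ← Real.rpow_mul zero_le_two, mul_div_assoc]
  constructor
  · refine mul_le_mul (Real.rpow_le_rpow_of_exponent_le one_le_two hvg) ?_ (by positivity)
      (by positivity)
    calc (1 / (Real.exp 1 * (d + 2 * u))) ^ ((1 : ℝ) / 2)
        ≤ (A / (d * Real.exp 1) / (A + 1)) ^ ((1 : ℝ) / 2) := by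
          refine Real.rpow_le_rpow (by positivity) ?_ (by norm_num)
          rw [div_div, div_le_div_iff₀ (by positivity) (by positivity)]
          have : (d : ℝ) ≤ 2 * A * u := by
            calc (d : ℝ) = 2 * A * (d * g) := by linear_combination (-2 * d : ℝ) * hAg
              _ ≤ 2 * A * u := mul_le_mul_of_nonneg_left hgu (by positivity)
          nlinarith [mul_le_mul_of_nonneg_left this he.le]
      _ = (A / (d * Real.exp 1)) ^ ((1 : ℝ) / 2) / (A + 1) ^ ((1 : ℝ) / 2) :=
          Real.div_rpow (by positivity) (by positivity) _
      _ ≤ P ^ g / Real.Gamma (A + 1) ^ g :=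
          div_le_div₀ (by positivity) hPl' (by positivity) hGu
  · rw [mul_assoc]
    refine mul_le_mul (Real.rpow_le_rpow_of_exponent_le one_le_two hgu) ?_ (by positivity)
      (by positivity)
    rw [div_eq_mul_inv]
    refine mul_le_mul (hPu'.trans ?_) ?_ (by positivity) (by positivity)
    · refine Real.rpow_le_rpow_of_exponent_le ?_ ?_
      · rw [le_div_iff₀ (by positivity)]
        linarith
      · rw [div_le_div_iff₀ two_pos (by positivity)]
        linarith
    · calc (Real.Gamma (A + 1) ^ g)⁻¹ ≤ ((A / Real.exp 1) ^ ((1 : ℝ) / 2))⁻¹ :=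
            inv_anti₀ (by positivity) hGl
        _ = (Real.exp 1 / A) ^ ((1 : ℝ) / 2) := by
            rw [← Real.inv_rpow (by positivity), inv_div]
        _ ≤ (2 * Real.exp 1 * u / d) ^ ((1 : ℝ) / 2) := by
            refine Real.rpow_le_rpow (by positivity) ?_ (by norm_num)
            have : 1 / A = 2 * g := by
              rw [div_eq_iff hA0.ne']
              linear_combination -2 * hAg
            rw [div_eq_mul_one_div, this, le_div_iff₀ hd0]
            nlinarith [mul_le_mul_of_nonneg_left hgu he.le]
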